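/- The same-size conjugacy class set of PSL(2,8) is {1, 63, 216, 224}. -/

import Mathlib

open scoped MatrixGroups

/-- The size of the conjugacy class of `x`. -/
noncomputable def classSize {G : Type*} [Group G] (x : G) : ℕ :=
  Nat.card {y : G // IsConj x y}

/-- `u_G(n)`: the number of elements of `G` whose conjugacy class has size `n`. -/
noncomputable def sameSizeCount (G : Type*) [Group G] (n : ℕ) : ℕ :=
  Nat.card {x : G // classSize x = n}

/-- `U(G)`: the same-size conjugacy class set of `G`. -/
def sameSizeSet (G : Type*) [Group G] : Set ℕ :=
  {m | ∃ x : G, m = sameSizeCount G (classSize x)}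

structure F8 where
  v : Fin 8
deriving DecidableEq

namespace F8

def equivFin : F8 ≃ Fin 8 := ⟨F8.v, F8.mk, fun _ => rfl, fun _ => rfl⟩
instance : Fintype F8 := Fintype.ofEquiv (Fin 8) equivFin.symm

def ofN (n : ℕ) : F8 := ⟨⟨n % 8, Nat.mod_lt _ (by norm_num)⟩⟩
def add' (a b : F8) : F8 := ofN (Nat.xor a.v.1 b.v.1)
def mul' (a b : F8) : F8 :=
  ofN (Nat.shiftRight 2821848294356612419217921029917578219971947684264937521152 (3 * (8 * a.v.1 + b.v.1)))

instance : Zero F8 := ⟨ofN 0⟩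
instance : One F8 := ⟨ofN 1⟩
instance : Add F8 := ⟨add'⟩
instance : Mul F8 := ⟨mul'⟩
instance : Neg F8 := ⟨id⟩
instance : Inv F8 := ⟨fun x => x * x * x * x * x * x⟩

theorem all_mk {p : F8 → Prop} (h : ∀ i : Fin 8, p ⟨i⟩) (a : F8) : p a := h a.v

instance : CommRing F8 where
  add_assoc := by decide +kernel
  zero_add := by decide +kernel
  add_zero := by decide +kernel
  add_comm := by decide +kernel
  mul_assoc := by decide +kernel
  one_mul := by decide +kernel
  mul_one := by decide +kernel
  mul_comm := by decide +kernel
  left_distrib := by decide +kernel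
  right_distrib := by decide +kernel
  zero_mul := by decide +kernel
  mul_zero := by decide +kernel
  neg_add_cancel := by decide +kernel
  nsmul := nsmulRec
  zsmul := zsmulRec

instance : Field F8 where
  exists_pair_ne := ⟨0, 1, by decide +kernel⟩
  mul_inv_cancel := by decide +kernel
  inv_zero := by decide +kernel
  nnqsmul := _
  qsmul := _

theorem add_self (a : F8) : a + a = 0 := by revert a; decide +kernel
theorem neg_eq (a : F8) : -a = a := rfl
theorem sub_eq (a b : F8) : a - b = a + b := by rw [sub_eq_add_neg, neg_eq]
theorem sqrt_inv (a : F8) (h : a ≠ 0) : ∃ s : F8, s * s * a = 1 := by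
  revert a; decide +kernel

end F8

theorem card_F8 : Nat.card F8 = 8 := by
  rw [Nat.card_congr F8.equivFin]; simp

theorem isConj_equiv {G H : Type*} [Group G] [Group H] (e : G ≃* H) (x y : G) :
    IsConj (e x) (e y) ↔ IsConj x y := by
  constructor
  · intro h
    simpa using e.symm.toMonoidHom.map_isConj h
  · intro h
    exact e.toMonoidHom.map_isConj h

theorem classSize_equiv {G H : Type*} [Group G] [Group H] (e : G ≃* H) (x : G) :
    classSize (e x) = classSize x :=
  (Nat.card_congr (e.toEquiv.subtypeEquiv fun y => (isConj_equiv e x y).symm)).symm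

theorem count_equiv {G H : Type*} [Group G] [Group H] (e : G ≃* H) (n : ℕ) :
    sameSizeCount H n = sameSizeCount G n :=
  (Nat.card_congr (e.toEquiv.subtypeEquiv fun y => by
    show _ ↔ classSize (e y) = n
    rw [classSize_equiv])).symm

theorem set_equiv {G H : Type*} [Group G] [Group H] (e : G ≃* H) :
    sameSizeSet G = sameSizeSet H := by
  ext m
  constructor
  · rintro ⟨x, rfl⟩
    exact ⟨e x, by rw [count_equiv e, classSize_equiv]⟩
  · rintro ⟨x, rfl⟩
    refine ⟨e.symm x, ?_⟩
    rw [count_equiv e, classSize_equiv]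

theorem center_bot : Subgroup.center SL(2, F8) = ⊥ := by
  rw [eq_bot_iff]
  intro x hx
  rw [Matrix.SpecialLinearGroup.mem_center_iff] at hx
  obtain ⟨r, hr, h⟩ := hx
  have : r = 1 := by
    revert r; simp only [Fintype.card_fin]; intro r hr _
    have : ∀ r : F8, r * r = 1 → r = 1 := by decide +kernel
    exact this r (by rw [← sq]; exact hr)
  subst this
  rw [Subgroup.mem_bot]
  ext i j
  rw [← h]; simp

def Q := F8 × F8 × F8 × F8
instance : Fintype Q := inferInstanceAs (Fintype (F8 × F8 × F8 × F8))
instance : DecidableEq Q := inferInstanceAs (DecidableEq (F8 × F8 × F8 × F8))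

def toQ (x : SL(2, F8)) : Q := (x.1 0 0, x.1 0 1, x.1 1 0, x.1 1 1)
def Q.det (p : Q) : F8 := p.1 * p.2.2.2 + p.2.1 * p.2.2.1
def Q.tr (p : Q) : F8 := p.1 + p.2.2.2
def Q.id : Q := (1, 0, 0, 1)

theorem det_toQ (x : SL(2, F8)) : (toQ x).det = 1 := by
  have := x.2
  rw [Matrix.det_fin_two, F8.sub_eq] at this
  exact this

def slEquiv : SL(2, F8) ≃ {p : Q // p.det = 1} where
  toFun x := ⟨toQ x, det_toQ x⟩
  invFun p := ⟨!![p.1.1, p.1.2.1; p.1.2.2.1, p.1.2.2.2], by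
    rw [Matrix.det_fin_two, F8.sub_eq]; exact p.2⟩
  left_inv x := by
    ext i j; fin_cases i <;> fin_cases j <;> rfl
  right_inv p := rfl

theorem toQ_inj {x y : SL(2, F8)} : toQ x = toQ y ↔ x = y := by
  constructor
  · intro h; exact slEquiv.injective (Subtype.ext h)
  · rintro rfl; rfl

theorem toQ_one : toQ 1 = Q.id := rfl

theorem card_sl (P : Q → Prop) [DecidablePred P] :
    Nat.card {x : SL(2, F8) // P (toQ x)} =
      (Finset.univ.filter fun p : Q => p.det = 1 ∧ P p).card := by
  rw [Nat.card_congr ((slEquiv.subtypeEquiv (p := fun x => P (toQ x)) (q := fun p => P p.1)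
    fun x => Iff.rfl).trans
    (Equiv.subtypeSubtypeEquivSubtypeInter (fun p : Q => p.det = 1) P))]
  rw [Nat.card_eq_fintype_card, Fintype.card_subtype]

def comp (t : F8) : SL(2, F8) := ⟨!![0, 1; 1, t], by
  rw [Matrix.det_fin_two, F8.sub_eq]; simp⟩

theorem conj_of (x g : SL(2, F8)) (h : x * g = g * comp (toQ x).tr) :
    IsConj x (comp (toQ x).tr) := by
  rw [isConj_iff]
  exact ⟨g⁻¹, by rw [mul_assoc, inv_inv, h, inv_mul_cancel_left]⟩

/-- conjugating matrix with columns `s v`, `s x v` -/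
theorem conj_comp (x : SL(2, F8)) (hx : x ≠ 1) : IsConj x (comp (toQ x).tr) := by
  have hd := det_toQ x
  set a := x.1 0 0 with ha
  set b := x.1 0 1 with hb
  set c := x.1 1 0 with hc
  set d := x.1 1 1 with hd'
  replace hd : a * d + b * c = 1 := hd
  have key : ∀ p q : F8, p * (c * p + d * q) + q * (a * p + b * q) ≠ 0 →
      IsConj x (comp (toQ x).tr) := by
    intro p q hpq
    obtain ⟨s, hs⟩ := F8.sqrt_inv _ hpq
    refine conj_of x ⟨!![s * p, s * (a * p + b * q); s * q, s * (c * p + d * q)], ?_⟩ ?_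
    · rw [Matrix.det_fin_two, F8.sub_eq, ← hs]; simp; ring
    · have htr : (toQ x).tr = a + d := rfl
      have h2 : ∀ u : F8, u + u = 0 := F8.add_self
      have hxm : x.1 = !![a, b; c, d] := by
        ext i j; fin_cases i <;> fin_cases j <;> rfl
      apply Subtype.ext
      show x.1 * !![s * p, s * (a * p + b * q); s * q, s * (c * p + d * q)] = 
        !![s * p, s * (a * p + b * q); s * q, s * (c * p + d * q)] * !![0, 1; 1, (toQ x).tr]
      rw [hxm, htr]
      clear_value a b c d
      ext i j; fin_cases i <;> fin_cases j <;> simp [Matrix.mul_apply, Fin.sum_univ_two]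
      · ring
      · linear_combination (-(s*p)) * hd + (b*c*s*p - s*p) * (h2 1)
      · ring
      · linear_combination (-(s*q)) * hd + (b*c*s*q - s*q) * (h2 1)
  by_cases h1 : c = 0
  · by_cases h2 : b = 0
    · by_cases h3 : a + d = 0
      · exfalso; apply hx; rw [← toQ_inj, toQ_one]
        have had : ∀ a d : F8, a + d = 0 → a * d = 1 → a = 1 ∧ d = 1 := by decide +kernel
        obtain ⟨e1, e2⟩ := had a d h3 (by rw [← hd, h1]; simp)
        show (a, b, c, d) = ((1, 0, 0, 1) : F8 × F8 × F8 × F8)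
        rw [e1, e2, h1, h2]
      · exact key 1 1 (by rw [h1, h2]; simpa [add_comm] using h3)
    · exact key 0 1 (by simpa using h2)
  · exact key 1 0 (by simpa using h1)

theorem tr_conj {x y : SL(2, F8)} (h : IsConj x y) : (toQ x).tr = (toQ y).tr := by
  rw [isConj_iff] at h
  obtain ⟨g, rfl⟩ := h
  have e : ∀ z : SL(2, F8), (toQ z).tr = Matrix.trace z.1 := fun z => by
    rw [Matrix.trace_fin_two]; rfl
  rw [e, e]
  show _ = Matrix.trace ((g * x).1 * (g⁻¹).1)
  rw [Matrix.trace_mul_comm, ← Matrix.SpecialLinearGroup.coe_mul, inv_mul_cancel_left]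

theorem conj_iff (x y : SL(2, F8)) (hx : x ≠ 1) :
    IsConj x y ↔ toQ y ≠ Q.id ∧ (toQ y).tr = (toQ x).tr := by
  rw [← toQ_one, Ne, toQ_inj]
  constructor
  · intro h
    refine ⟨?_, (tr_conj h).symm⟩
    rintro rfl
    exact hx (isConj_one_left.1 h)
  · rintro ⟨h1, h2⟩
    have := conj_comp y h1
    rw [h2] at this
    exact (conj_comp x hx).trans this.symm

def Q.size (p : Q) : ℕ := if p = Q.id then 1 else
  if p.tr = 0 then 63 else if p.tr.v.1 = 1 ∨ p.tr.v.1 = 2 ∨ p.tr.v.1 = 4 ∨ p.tr.v.1 = 6 then 56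
  else 72

theorem class_size (x : SL(2, F8)) : classSize x = (toQ x).size := by
  by_cases hx : x = 1
  · subst hx
    have : (toQ (1 : SL(2, F8))).size = 1 := by rw [toQ_one]; rfl
    rw [this, classSize]
    have e : ∀ y : SL(2, F8), IsConj 1 y ↔ y = 1 := fun y => isConj_one_right
    simp [e]
  · rw [classSize, Nat.card_congr (Equiv.subtypeEquivRight fun y => conj_iff x y hx),
      card_sl (fun p => p ≠ Q.id ∧ p.tr = (toQ x).tr)]
    rw [← toQ_inj, toQ_one] at hx
    rw [Q.size, if_neg hx]
    generalize (toQ x).tr = t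
    revert t
    decide +kernel

theorem count_sl (n : ℕ) : sameSizeCount SL(2, F8) n =
    (Finset.univ.filter fun p : Q => p.det = 1 ∧ p.size = n).card := by
  rw [sameSizeCount, ← card_sl (fun p => p.size = n)]
  simp only [class_size]

theorem set_sl : sameSizeSet SL(2, F8) = {1, 63, 216, 224} := by
  have h1 : sameSizeCount SL(2, F8) 1 = 1 := by rw [count_sl]; decide +kernel
  have h2 : sameSizeCount SL(2, F8) 63 = 63 := by rw [count_sl]; decide +kernel
  have h3 : sameSizeCount SL(2, F8) 72 = 216 := by rw [count_sl]; decide +kernel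
  have h4 : sameSizeCount SL(2, F8) 56 = 224 := by rw [count_sl]; decide +kernel
  have ex : ∀ n m, sameSizeCount SL(2, F8) n = m → m ≠ 0 → m ∈ sameSizeSet SL(2, F8) := by
    intro n m h hm
    have : Nat.card {x : SL(2, F8) // classSize x = n} ≠ 0 := by rw [← h] at hm; exact hm
    obtain ⟨⟨⟨x, hx⟩⟩, _⟩ := Nat.card_ne_zero.1 this
    exact ⟨x, by rw [hx, h]⟩
  ext m
  simp only [Set.mem_insert_iff, Set.mem_singleton_iff]
  constructor
  · rintro ⟨x, rfl⟩
    rw [class_size, Q.size]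
    split_ifs <;> simp [h1, h2, h3, h4]
  · rintro (rfl | rfl | rfl | rfl)
    · exact ex 1 _ h1 (by norm_num)
    · exact ex 63 _ h2 (by norm_num)
    · exact ex 72 _ h3 (by norm_num)
    · exact ex 56 _ h4 (by norm_num)

theorem sl_equiv {K L : Type*} [Field K] [Field L] (e : K ≃+* L) :
    Nonempty (SL(2, K) ≃* SL(2, L)) :=
  ⟨MulEquiv.ofBijective (Matrix.SpecialLinearGroup.map e.toRingHom) (by
    constructor
    · intro x y h
      ext i j
      have := congrArg (fun z : SL(2, L) => z.1 i j) h
      exact e.injective this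
    · intro y
      refine ⟨Matrix.SpecialLinearGroup.map e.symm.toRingHom y, ?_⟩
      ext i j
      exact e.apply_symm_apply _)⟩

theorem stmt_12 : sameSizeSet (PSL(2, GaloisField 2 3)) = {1, 63, 216, 224} := by
  have hc : Nat.card (GaloisField 2 3) = 8 := by
    rw [GaloisField.card 2 3 (by norm_num)]; norm_num
  have : Fintype (GaloisField 2 3) := Fintype.ofFinite _
  let e : GaloisField 2 3 ≃+* F8 := FiniteField.ringEquivOfCardEq (by
    rw [← Nat.card_eq_fintype_card, ← Nat.card_eq_fintype_card, hc, card_F8])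
  obtain ⟨f⟩ := sl_equiv e
  have hb : Subgroup.center SL(2, GaloisField 2 3) = ⊥ := by
    rw [eq_bot_iff]
    intro x hx
    have : f x ∈ Subgroup.center SL(2, F8) := by
      rw [Subgroup.mem_center_iff] at hx ⊢
      intro g
      have := congrArg f (hx (f.symm g))
      simpa using this
    rw [center_bot, Subgroup.mem_bot] at this
    rw [Subgroup.mem_bot]
    exact f.injective (by rw [this, map_one])
  have g : PSL(2, GaloisField 2 3) ≃* SL(2, GaloisField 2 3) :=
    (QuotientGroup.quotientMulEquivOfEq hb).trans QuotientGroup.quotientBot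
  rw [set_equiv (g.trans f), set_sl]
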